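/- Let α > 1/2 and let a(x) = c_α (1+|x|²)^{-α} with c_α > 0 the constant making ∫_ℝ a = 1. Then for every γ ∈ (1/(2α), 1), the ratio (a * a^γ)(x) / a^γ(x) converges to 1 as |x| → ∞, where (a*a^γ)(x) = ∫_ℝ a(y) a^γ(x−y) dy and a^γ(x) = (a(x))^γ. -/

import Mathlib

open MeasureTheory Real Set Filter

lemma aux_int (β : ℝ) (hβ : 1 / 2 < β) : Integrable (fun z : ℝ => (1 + |z| ^ 2) ^ (-β)) := by
  have h := integrable_rpow_neg_one_add_norm_sq (E := ℝ) (μ := volume) (r := 2 * β)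
    (by simp; linarith)
  refine h.congr (Eventually.of_forall fun z => ?_)
  simp only [Real.norm_eq_abs]
  congr 1
  ring

lemma aux_abs : Tendsto (fun x : ℝ => |x|) (Filter.comap (fun x : ℝ => |x|) atTop) atTop :=
  tendsto_comap

lemma aux_w : Tendsto (fun x : ℝ => 1 + |x| ^ 2) (Filter.comap (fun x : ℝ => |x|) atTop) atTop :=
  tendsto_atTop_add_const_left _ _ ((tendsto_pow_atTop (by norm_num)).comp aux_abs)

lemma aux_ratio (y : ℝ) : Tendsto (fun x : ℝ => (1 + |x| ^ 2) / (1 + |x - y| ^ 2))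
    (Filter.comap (fun x : ℝ => |x|) atTop) (nhds 1) := by
  have h0 : Tendsto (fun x : ℝ => (y ^ 2 + 2 * |y|) / |x|)
      (Filter.comap (fun x : ℝ => |x|) atTop) (nhds 0) :=
    tendsto_const_nhds.div_atTop aux_abs
  have h1 : Tendsto (fun x : ℝ => (1 + |x - y| ^ 2) / (1 + |x| ^ 2) - 1)
      (Filter.comap (fun x : ℝ => |x|) atTop) (nhds 0) := by
    refine squeeze_zero_norm' ?_ h0
    filter_upwards [aux_abs.eventually_ge_atTop 1] with x hx
    have hw : 0 < 1 + |x| ^ 2 := by positivity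
    have e : (1 + |x - y| ^ 2) / (1 + |x| ^ 2) - 1 = (y ^ 2 - 2 * (x * y)) / (1 + |x| ^ 2) := by
      field_simp
      simp only [sq_abs]
      ring
    rw [e, Real.norm_eq_abs, abs_div, abs_of_pos hw, div_le_div_iff₀ hw (by linarith)]
    have h2 : |y ^ 2 - 2 * (x * y)| ≤ y ^ 2 + 2 * (|x| * |y|) := by
      refine (abs_sub _ _).trans ?_
      simp [abs_mul]
    have hy := abs_nonneg y
    have h3 : y ^ 2 + 2 * (|x| * |y|) ≤ (y ^ 2 + 2 * |y|) * |x| := by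
      nlinarith [sq_nonneg y]
    calc _ ≤ (y ^ 2 + 2 * |y|) * |x| * |x| := by
          gcongr
          exact h2.trans h3
      _ ≤ _ := by nlinarith [sq_nonneg y]
  have h2 := (h1.add_const 1).inv₀ (by norm_num)
  simpa using h2

theorem stmt_10
    (α cα : ℝ) (hα : 1 / 2 < α) (hcα : 0 < cα)
    (a : ℝ → ℝ) (ha : ∀ x : ℝ, a x = cα * (1 + |x| ^ 2) ^ (-α))
    (hnorm : ∫ x : ℝ, a x = 1) :
    ∀ γ : ℝ, γ ∈ Ioo (1 / (2 * α)) 1 →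
      Tendsto (fun x : ℝ => (∫ y : ℝ, a y * (a (x - y)) ^ γ) / (a x) ^ γ)
        (Filter.comap (fun x : ℝ => |x|) atTop) (nhds 1) := by
  rintro γ ⟨hγ1, hγ2⟩
  set l := Filter.comap (fun x : ℝ => |x|) atTop with hl
  obtain ⟨β, hβ⟩ : ∃ β, β = α * γ := ⟨_, rfl⟩
  have hβ1 : 1 / 2 < β := by
    rw [div_lt_iff₀ (by linarith)] at hγ1
    rw [hβ]; linarith
  have hβ2 : β < α := by rw [hβ]; nlinarith
  have hβ0 : 0 < β := by linarith
  have hw : ∀ x : ℝ, 0 < 1 + |x| ^ 2 := fun x => by positivity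
  have hapos : ∀ x, 0 < a x := fun x => by
    rw [ha]; exact mul_pos hcα (rpow_pos_of_pos (hw x) _)
  have haint : Integrable a := by
    by_contra h
    rw [integral_undef h] at hnorm
    norm_num at hnorm
  -- ratio
  have hr : ∀ x y, (a (x - y)) ^ γ / (a x) ^ γ = ((1 + |x| ^ 2) / (1 + |x - y| ^ 2)) ^ β := by
    intro x y
    have := rpow_nonneg (hw x).le (-α)
    have := rpow_nonneg (hw (x - y)).le (-α)
    rw [ha, ha, mul_rpow hcα.le (by assumption), mul_rpow hcα.le (by assumption),
      mul_div_mul_left _ _ (rpow_pos_of_pos hcα γ).ne', ← rpow_mul (hw _).le, ← rpow_mul (hw _).le,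
      div_rpow (hw _).le (hw _).le, neg_mul, ← hβ, rpow_neg (hw _).le, rpow_neg (hw _).le]
    field_simp
  let F : ℝ → ℝ → ℝ := fun x y => a y * ((1 + |x| ^ 2) / (1 + |x - y| ^ 2)) ^ β
  have hF : ∀ x, (∫ y : ℝ, a y * (a (x - y)) ^ γ) / (a x) ^ γ = ∫ y, F x y := by
    intro x
    rw [← integral_div]
    congr 1
    ext y
    simp only [F]
    rw [← hr, mul_div_assoc]
  simp_rw [hF]
  have hF0 : ∀ x y, 0 ≤ F x y := fun x y =>
    mul_nonneg (hapos y).le (rpow_nonneg (div_nonneg (hw _).le (hw _).le) _)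
  have hac : Measurable a := by
    have : a = fun x => cα * (1 + |x| ^ 2) ^ (-α) := funext ha
    rw [this]; fun_prop
  have hFm : ∀ x, Measurable (F x) := fun x => by
    simp only [F]; fun_prop
  let S : ℝ → Set ℝ := fun x => {y | |x| ≤ 2 * |x - y|}
  have hS : ∀ x, MeasurableSet (S x) := fun x =>
    measurableSet_le measurable_const (by fun_prop)
  have hb1 : ∀ x y, ‖(S x).indicator (F x) y‖ ≤ a y * 4 ^ β := by
    intro x y
    by_cases hy : y ∈ S x
    · rw [indicator_of_mem hy, Real.norm_of_nonneg (hF0 x y)]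
      have hy' : |x| ≤ 2 * |x - y| := hy
      have := hapos y
      have := hw (x - y)
      simp only [F]
      gcongr
      rw [div_le_iff₀ (hw _)]
      nlinarith [abs_nonneg x, abs_nonneg (x - y)]
    · rw [indicator_of_notMem hy]
      have := hapos y
      simp; positivity
  have hb2 : ∀ x y, ‖(S x)ᶜ.indicator (F x) y‖ ≤
      cα * 4 ^ α * (1 + |x| ^ 2) ^ (β - α) * (1 + |x - y| ^ 2) ^ (-β) := by
    intro x y
    have h1 := hw x
    have h2 := hw (x - y)
    by_cases hy : y ∈ (S x)ᶜ
    · rw [indicator_of_mem hy, Real.norm_of_nonneg (hF0 x y)]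
      have hy' : 2 * |x - y| < |x| := not_le.1 hy
      have h3 : |x| ≤ 2 * |y| := by
        have : |x| ≤ |x - y| + |y| := by simpa using abs_add_le (x - y) y
        linarith
      have h4 : a y ≤ cα * (4 ^ α * (1 + |x| ^ 2) ^ (-α)) := by
        rw [ha]
        gcongr
        have h5 : (1 + |y| ^ 2) ^ (-α) ≤ ((1 + |x| ^ 2) / 4) ^ (-α) := by
          apply rpow_le_rpow_of_nonpos (by positivity) _ (by linarith)
          nlinarith [abs_nonneg x, abs_nonneg y]
        refine h5.trans_eq ?_
        rw [div_rpow h1.le (by norm_num), rpow_neg (by norm_num : (0:ℝ) ≤ 4)]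
        field_simp
      have h6 : F x y ≤ cα * (4 ^ α * (1 + |x| ^ 2) ^ (-α)) *
          ((1 + |x| ^ 2) / (1 + |x - y| ^ 2)) ^ β := by
        simp only [F]; gcongr
      refine h6.trans_eq ?_
      rw [div_rpow h1.le h2.le, sub_eq_add_neg β α, rpow_add h1, rpow_neg h2.le β]
      field_simp
    · rw [indicator_of_notMem hy]
      simp only [norm_zero]; positivity
  have hint1 : ∀ x, Integrable ((S x).indicator (F x)) := fun x =>
    (haint.mul_const (4 ^ β)).mono' ((hFm x).indicator (hS x)).aestronglyMeasurable
      (Eventually.of_forall (hb1 x))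
  have hdom2 : ∀ x : ℝ, Integrable (fun y : ℝ =>
      cα * 4 ^ α * (1 + |x| ^ 2) ^ (β - α) * (1 + |x - y| ^ 2) ^ (-β)) := fun x =>
    ((aux_int β hβ1).comp_sub_left x).const_mul _
  have hint2 : ∀ x, Integrable ((S x)ᶜ.indicator (F x)) := fun x =>
    (hdom2 x).mono' ((hFm x).indicator (hS x).compl).aestronglyMeasurable
      (Eventually.of_forall (hb2 x))
  have hsplit : ∀ x, ∫ y, F x y =
      (∫ y, (S x).indicator (F x) y) + ∫ y, (S x)ᶜ.indicator (F x) y := by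
    intro x
    rw [← integral_add (hint1 x) (hint2 x)]
    congr 1
    ext y
    exact (congrFun (indicator_self_add_compl (S x) (F x)) y).symm
  simp_rw [hsplit]
  have hlim2 : Tendsto (fun x => ∫ y, (S x)ᶜ.indicator (F x) y) l (nhds 0) := by
    have hb : ∀ x, ‖∫ y, (S x)ᶜ.indicator (F x) y‖ ≤
        cα * 4 ^ α * (1 + |x| ^ 2) ^ (β - α) * ∫ z : ℝ, (1 + |z| ^ 2) ^ (-β) := by
      intro x
      refine (norm_integral_le_of_norm_le (hdom2 x) (Eventually.of_forall (hb2 x))).trans_eq ?_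
      rw [integral_const_mul,
        integral_sub_left_eq_self (fun z : ℝ => (1 + |z| ^ 2) ^ (-β)) volume x]
    refine squeeze_zero_norm hb ?_
    have h := (tendsto_rpow_neg_atTop (sub_pos.2 hβ2)).comp aux_w
    have h' := (h.const_mul (cα * 4 ^ α)).mul_const (∫ z : ℝ, (1 + |z| ^ 2) ^ (-β))
    simp only [Function.comp_def, neg_sub, mul_zero, zero_mul] at h'
    exact h'
  have hlim1 : Tendsto (fun x => ∫ y, (S x).indicator (F x) y) l (nhds (∫ y, a y)) := by
    refine tendsto_integral_filter_of_dominated_convergence (fun y => a y * 4 ^ β)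
      (Eventually.of_forall fun x => (hint1 x).aestronglyMeasurable)
      (Eventually.of_forall fun x => Eventually.of_forall (hb1 x))
      (haint.mul_const _) (Eventually.of_forall fun y => ?_)
    have h1 : Tendsto (fun x => F x y) l (nhds (a y)) := by
      have := ((aux_ratio y).rpow_const (p := β) (Or.inl one_ne_zero)).const_mul (a y)
      rw [one_rpow, mul_one] at this
      exact this
    refine h1.congr' ?_
    filter_upwards [aux_abs.eventually_ge_atTop (2 * |y|)] with x hx
    have : y ∈ S x := by
      change |x| ≤ 2 * |x - y|
      have : |x| ≤ |x - y| + |y| := by simpa using abs_add_le (x - y) y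
      linarith
    rw [indicator_of_mem this]
  rw [hnorm] at hlim1
  simpa using hlim1.add hlim2
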